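/- arXiv:2112.15565 — 9 statements merged into one kernel-verified Lean document; each statement's English description precedes it below -/
import Mathlib

section
/- Let (V,d) be a finite pseudo-metric space with a partition V = V₊ ∪ V₋ where |V₊| = |V₋|. Suppose f : V → ℝ is 1-Lipschitz (i.e. |f(x) − f(y)| ≤ d(x,y) for all x,y ∈ V) and f maximizes the quantity ∑_{x ∈ V₊} g(x) − ∑_{y ∈ V₋} g(y) among all 1-Lipschitz functions g : V → ℝ. Then there exists a bijection π : V₊ → V₋ such that f(x) − f(π(x)) = d(x, π(x)) for every x ∈ V₊. -/
/-- A finite family of positive reals is bounded below by a positive real. -/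
theorem Finset.exists_pos_forall_le {ι : Type*} (s : Finset ι) (h : ι → ℝ)
    (hpos : ∀ i ∈ s, 0 < h i) : ∃ ε > 0, ∀ i ∈ s, ε ≤ h i := by
  rcases s.eq_empty_or_nonempty with rfl | hs
  · exact ⟨1, one_pos, by simp⟩
  · obtain ⟨i, hi, hmin⟩ := s.exists_min_image h hs
    exact ⟨h i, hpos i hi, hmin⟩

/-- Raising a maximizer `f` on a set `U` that no tight pair leaves keeps `f` Lipschitz, so such a
`U` contains at most as many points of `P` as of `M`. -/
theorem card_inter_le_card_inter_of_tight_closed {V : Type*} [Fintype V] [DecidableEq V]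
    {d : V → V → ℝ} (hd_symm : ∀ x y, d x y = d y x) {P M U : Finset V} {f : V → ℝ}
    (hf : ∀ x y, |f x - f y| ≤ d x y)
    (hmax : ∀ g : V → ℝ, (∀ x y, |g x - g y| ≤ d x y) →
      ∑ x ∈ P, g x - ∑ y ∈ M, g y ≤ ∑ x ∈ P, f x - ∑ y ∈ M, f y)
    (hU : ∀ x ∈ U, ∀ y, f x - f y = d x y → y ∈ U) :
    (P ∩ U).card ≤ (M ∩ U).card := by
  obtain ⟨ε, hε, hle⟩ := Finset.exists_pos_forall_le (U ×ˢ Uᶜ)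
    (fun p ↦ d p.1 p.2 - (f p.1 - f p.2)) (by
      rintro ⟨x, y⟩ hp
      rw [Finset.mem_product, Finset.mem_compl] at hp
      exact sub_pos.2 (lt_of_le_of_ne ((le_abs_self _).trans (hf x y))
        fun h ↦ hp.2 (hU x hp.1 y h)))
  have hslack : ∀ x ∈ U, ∀ y ∉ U, ε ≤ d x y - (f x - f y) := fun x hx y hy ↦
    hle (x, y) (Finset.mem_product.2 ⟨hx, Finset.mem_compl.2 hy⟩)
  have hsum : ∀ A : Finset V, ∑ x ∈ A, (f x + if x ∈ U then ε else 0) =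
      ∑ x ∈ A, f x + (A ∩ U).card * ε := by
    intro A
    rw [Finset.sum_add_distrib, Finset.sum_ite_mem, Finset.sum_const, nsmul_eq_mul]
  have key := hmax (fun x ↦ f x + if x ∈ U then ε else 0) (by
    intro x y
    have h := abs_le.1 (hf x y)
    rw [abs_le]
    by_cases hx : x ∈ U <;> by_cases hy : y ∈ U <;> simp only [hx, hy, if_true, if_false]
    · constructor <;> linarith
    · have := hslack x hx y hy
      constructor <;> linarith
    · have := hslack y hy x hx
      have := hd_symm x y
      constructor <;> linarith
    · constructor <;> linarith)
  rw [hsum, hsum] at key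
  have : ((P ∩ U).card : ℝ) * ε ≤ (M ∩ U).card * ε := by linarith
  exact_mod_cast le_of_mul_le_mul_right this hε


/-- Let `(V,d)` be a finite pseudo-metric space with a partition
`V = V₊ ∪ V₋` where `|V₊| = |V₋|`. If `f : V → ℝ` is `1`-Lipschitz and maximizes
`∑_{x ∈ V₊} g x − ∑_{y ∈ V₋} g y` among all `1`-Lipschitz `g`, then there is a bijection
`π : V₊ → V₋` with `f x − f (π x) = d (x, π x)` for every `x ∈ V₊`. -/
theorem stmt_0 (V : Type) [Fintype V] [DecidableEq V] (d : V → V → ℝ)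
    (hd_self : ∀ x, d x x = 0)
    (hd_symm : ∀ x y, d x y = d y x)
    (hd_nonneg : ∀ x y, 0 ≤ d x y)
    (hd_tri : ∀ x y z, d x z ≤ d x y + d y z)
    (Vp Vm : Finset V)
    (hpart : Vp ∪ Vm = Finset.univ)
    (hdisj : Disjoint Vp Vm)
    (hcard : Vp.card = Vm.card)
    (f : V → ℝ)
    (hf : ∀ x y, |f x - f y| ≤ d x y)
    (hmax : ∀ g : V → ℝ, (∀ x y, |g x - g y| ≤ d x y) →
      ∑ x ∈ Vp, g x - ∑ y ∈ Vm, g y ≤ ∑ x ∈ Vp, f x - ∑ y ∈ Vm, f y) :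
    ∃ π : V → V, Set.BijOn π ↑Vp ↑Vm ∧ ∀ x ∈ Vp, f x - f (π x) = d x (π x) := by
  classical
  have hall : ∀ s : Finset Vp, s.card ≤
      (s.biUnion fun x ↦ Vm.filter fun y ↦ f x - f y = d x y).card := by
    intro s
    let U : Finset V := Finset.univ.filter fun y ↦ ∃ x ∈ s, f x - f y = d x y
    have hU : ∀ x ∈ U, ∀ y, f x - f y = d x y → y ∈ U := by
      intro x hx y hxy
      obtain ⟨z, hz, hzx⟩ := (Finset.mem_filter.1 hx).2
      refine Finset.mem_filter.2 ⟨Finset.mem_univ y, z, hz, ?_⟩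
      have h₁ := hd_tri z x y
      have h₂ := (abs_le.1 (hf z y)).2
      linarith
    calc s.card = (s.map (Function.Embedding.subtype _)).card := (Finset.card_map _).symm
      _ ≤ (Vp ∩ U).card := Finset.card_le_card fun x hx ↦ by
        obtain ⟨z, hz, rfl⟩ := Finset.mem_map.1 hx
        exact Finset.mem_inter.2 ⟨z.2, Finset.mem_filter.2
          ⟨Finset.mem_univ _, z, hz, by simp [hd_self]⟩⟩
      _ ≤ (Vm ∩ U).card := card_inter_le_card_inter_of_tight_closed hd_symm hf hmax hU
      _ ≤ _ := Finset.card_le_card fun y hy ↦ by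
        obtain ⟨hyM, hyU⟩ := Finset.mem_inter.1 hy
        obtain ⟨x, hx, hxy⟩ := (Finset.mem_filter.1 hyU).2
        exact Finset.mem_biUnion.2 ⟨x, hx, Finset.mem_filter.2 ⟨hyM, hxy⟩⟩
  obtain ⟨φ, hφ, hmem⟩ :=
    (Finset.all_card_le_biUnion_card_iff_exists_injective _).1 hall
  let π : V → V := fun x ↦ if hx : x ∈ Vp then φ ⟨x, hx⟩ else x
  have hπ : ∀ x (hx : x ∈ Vp), π x = φ ⟨x, hx⟩ := fun x hx ↦ dif_pos hx
  have hmaps : Set.MapsTo π Vp Vm := fun x hx ↦ by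
    rw [hπ x hx]
    exact (Finset.mem_filter.1 (hmem ⟨x, hx⟩)).1
  have hinj : Set.InjOn π Vp := fun x hx y hy h ↦ by
    rw [hπ x hx, hπ y hy] at h
    exact congrArg Subtype.val (hφ h)
  refine ⟨π, ⟨hmaps, hinj, Finset.surjOn_of_injOn_of_card_le π hmaps hinj hcard.ge⟩,
    fun x hx ↦ ?_⟩
  rw [hπ x hx]
  exact (Finset.mem_filter.1 (hmem ⟨x, hx⟩)).2
end

section
/- Let (V,d) be a finite pseudo-metric space with a partition V = V₊ ∪ V₋ where |V₊| = |V₋|. Suppose f : V → ℝ is 1-Lipschitz and f maximizes the quantity ∑_{x ∈ V₊} g(x) − ∑_{y ∈ V₋} g(y) among all 1-Lipschitz functions g : V → ℝ. For A ⊆ V₊ define Γ(A) := {y ∈ V₋ : there exists x ∈ A with f(x) − f(y) = d(x,y)}. Then |A| ≤ |Γ(A)| for every subset A ⊆ V₊; that is, the bipartite graph on V₊ × V₋ with edge set {(x,y) : f(x) − f(y) = d(x,y)} satisfies the hypothesis of Hall's marriage theorem. -/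
open Classical

/-- If a set `S` is closed under passing along tight pairs `f z - f w = d z w`, then `f` can be
raised by a positive constant on `S` and remain `1`-Lipschitz. -/
lemma exists_pos_lipschitz_raise {V : Type*} [Finite V] {d : V → V → ℝ}
    (hd_symm : ∀ x y, d x y = d y x) {f : V → ℝ}
    (hf : ∀ x y, |f x - f y| ≤ d x y) {S : Set V}
    (hS : ∀ z ∈ S, ∀ w, f z - f w = d z w → w ∈ S) :
    ∃ ε > 0, ∀ x y,
      |(f x + if x ∈ S then ε else 0) - (f y + if y ∈ S then ε else 0)| ≤ d x y := by
  have hev : ∀ᶠ ε : ℝ in nhdsWithin 0 (Set.Ioi 0),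
      ∀ z w, z ∈ S → w ∉ S → ε ≤ d z w - (f z - f w) := by
    refine Filter.eventually_all.2 fun z => Filter.eventually_all.2 fun w => ?_
    by_cases h : z ∈ S ∧ w ∉ S
    · have hlt : 0 < d z w - (f z - f w) :=
        sub_pos.2 (lt_of_le_of_ne ((le_abs_self _).trans (hf z w)) fun e => h.2 (hS z h.1 w e))
      filter_upwards [nhdsWithin_le_nhds (Iic_mem_nhds hlt)] with ε hε _ _ using hε
    · exact Filter.Eventually.of_forall fun ε hz hw => (h ⟨hz, hw⟩).elim
  obtain ⟨ε, hε, hpos⟩ := (hev.and self_mem_nhdsWithin).exists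
  refine ⟨ε, hpos, fun x y => ?_⟩
  have hpos' : 0 < ε := hpos
  have hxy := abs_le.1 (hf x y)
  by_cases hx : x ∈ S <;> by_cases hy : y ∈ S <;> simp only [hx, hy, if_true, if_false] <;>
    rw [abs_le]
  · constructor <;> linarith
  · have := hε x y hx hy
    constructor <;> linarith
  · have := hε y x hy hx
    rw [hd_symm y x] at this
    constructor <;> linarith
  · constructor <;> linarith

/-- Let `(V,d)` be a finite pseudo-metric space with a partition
`V = V₊ ∪ V₋` where `|V₊| = |V₋|`, and let `f : V → ℝ` be a `1`-Lipschitz maximizer of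
`∑_{x ∈ V₊} g x − ∑_{y ∈ V₋} g y` among `1`-Lipschitz functions `g`. For `A ⊆ V₊` let
`Γ(A) := {y ∈ V₋ : ∃ x ∈ A, f x − f y = d x y}`. Then `|A| ≤ |Γ(A)|` for every `A ⊆ V₊`,
i.e. the bipartite graph with edges `{(x,y) : f x − f y = d x y}` satisfies the hypothesis of
Hall's marriage theorem. -/
theorem stmt_1 (V : Type) [Fintype V] [DecidableEq V] (d : V → V → ℝ)
    (hd_self : ∀ x, d x x = 0)
    (hd_symm : ∀ x y, d x y = d y x)
    (hd_nonneg : ∀ x y, 0 ≤ d x y)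
    (hd_tri : ∀ x y z, d x z ≤ d x y + d y z)
    (Vp Vm : Finset V)
    (hpart : Vp ∪ Vm = Finset.univ)
    (hdisj : Disjoint Vp Vm)
    (hcard : Vp.card = Vm.card)
    (f : V → ℝ)
    (hf : ∀ x y, |f x - f y| ≤ d x y)
    (hmax : ∀ g : V → ℝ, (∀ x y, |g x - g y| ≤ d x y) →
      ∑ x ∈ Vp, g x - ∑ y ∈ Vm, g y ≤ ∑ x ∈ Vp, f x - ∑ y ∈ Vm, f y) :
    ∀ A ⊆ Vp, A.card ≤ (Vm.filter (fun y => ∃ x ∈ A, f x - f y = d x y)).card := by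
  intro A hA
  obtain ⟨S, hmem⟩ : ∃ S : Set V, ∀ z, z ∈ S ↔ ∃ x ∈ A, f x - f z = d x z :=
    ⟨{z | ∃ x ∈ A, f x - f z = d x z}, fun _ => Iff.rfl⟩
  have hS : ∀ z ∈ S, ∀ w, f z - f w = d z w → w ∈ S := by
    intro z hz w hzw
    obtain ⟨x, hx, hxz⟩ := (hmem z).1 hz
    refine (hmem w).2 ⟨x, hx, le_antisymm ((le_abs_self _).trans (hf x w)) ?_⟩
    linarith [hd_tri x z w]
  obtain ⟨ε, hε, hlip⟩ := exists_pos_lipschitz_raise hd_symm hf hS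
  have hle := hmax _ hlip
  simp only [Finset.sum_add_distrib, ← Finset.sum_filter, Finset.sum_const, nsmul_eq_mul] at hle
  have hcards : (Vp.filter (· ∈ S)).card ≤ (Vm.filter (· ∈ S)).card := by
    have : ((Vp.filter (· ∈ S)).card : ℝ) ≤ (Vm.filter (· ∈ S)).card :=
      le_of_mul_le_mul_right (by linarith) hε
    exact_mod_cast this
  have hAS : A ⊆ Vp.filter (· ∈ S) := fun x hx =>
    Finset.mem_filter.2 ⟨hA hx, (hmem x).2 ⟨x, hx, by rw [sub_self, hd_self]⟩⟩
  simp only [← hmem]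
  exact (Finset.card_le_card hAS).trans hcards
end

section
/- Let X be a metric space, k ≥ 1, and let x₁,…,x_k and y₁,…,y_k be (not necessarily distinct) points of X. Then the supremum over all 1-Lipschitz functions f : X → ℝ of ∑_{i=1}^k (f(x_i) − f(y_i)) equals the minimum over all permutations π of {1,…,k} of ∑_{i=1}^k d(x_i, y_{π(i)}). In particular, the supremum is attained and is equal to one of these finite sums. -/
/-- If the diagonal of `w` vanishes and every permutation has nonnegative total weight, then so does
every nonnegative circulation, by Birkhoff's theorem. -/
theorem circulation_weight_nonneg {ι : Type*} [Fintype ι] [DecidableEq ι] {w : ι → ι → ℝ}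
    (hdiag : ∀ i, w i i = 0) (hperm : ∀ σ : Equiv.Perm ι, 0 ≤ ∑ i, w i (σ i))
    {N : Matrix ι ι ℝ} (hN : ∀ i j, 0 ≤ N i j) (hcirc : ∀ i, ∑ j, N i j = ∑ j, N j i) :
    0 ≤ ∑ i, ∑ j, w i j * N i j := by
  set s : ℝ := ∑ i, ∑ j, N i j with hs
  have hrow : ∀ i, ∑ j, N i j ≤ s := fun i =>
    Finset.single_le_sum (f := fun i => ∑ j, N i j)
      (fun i _ => Finset.sum_nonneg fun j _ => hN i j) (Finset.mem_univ i)
  have hs0 : 0 ≤ s := Finset.sum_nonneg fun i _ => Finset.sum_nonneg fun j _ => hN i j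
  obtain ⟨M, hM, hNM⟩ := (exists_mem_doublyStochastic_eq_smul_iff
      (M := N + Matrix.diagonal fun i => s - ∑ j, N i j) hs0).2 <| by
    refine ⟨fun i j => ?_, fun i => ?_, fun j => ?_⟩
    · rw [Matrix.add_apply, Matrix.diagonal_apply]
      split_ifs
      · linarith [hN i j, hrow i]
      · linarith [hN i j]
    · simp [Finset.sum_add_distrib, Matrix.diagonal_apply]
    · simp [Finset.sum_add_distrib, Matrix.diagonal_apply, hcirc]
  obtain ⟨v, hv, -, rfl⟩ := exists_eq_sum_perm_of_mem_doublyStochastic hM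
  have hentry : ∀ i j, w i j * N i j =
      s * ∑ σ : Equiv.Perm ι, v σ * (if σ i = j then w i j else 0) := by
    intro i j
    have h := congrFun (congrFun hNM i) j
    simp only [Matrix.add_apply, Matrix.smul_apply, Matrix.sum_apply, Equiv.Perm.permMatrix,
      PEquiv.toMatrix_apply, Equiv.toPEquiv_apply, Option.mem_def, Option.some.injEq,
      smul_eq_mul] at h
    have hd : w i j * Matrix.diagonal (fun i => s - ∑ j, N i j) i j = 0 := by
      rw [Matrix.diagonal_apply]
      split_ifs with hij
      · rw [← hij, hdiag, zero_mul]
      · rw [mul_zero]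
    calc w i j * N i j = w i j * (N i j + Matrix.diagonal (fun i => s - ∑ j, N i j) i j) := by
          rw [mul_add, hd, add_zero]
      _ = _ := by
          rw [h, mul_left_comm, Finset.mul_sum]
          congr 1
          refine Finset.sum_congr rfl fun σ _ => ?_
          split_ifs <;> ring
  have hsum : ∑ i, ∑ j, w i j * N i j = s * ∑ σ : Equiv.Perm ι, v σ * ∑ i, w i (σ i) := by
    simp_rw [hentry, ← Finset.mul_sum]
    congr 1
    simp_rw [Finset.sum_comm (s := Finset.univ (α := ι)) (t := Finset.univ (α := Equiv.Perm ι)),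
      ← Finset.mul_sum, Finset.sum_ite_eq, Finset.mem_univ, if_true]
  rw [hsum]
  exact mul_nonneg hs0 (Finset.sum_nonneg fun σ _ => mul_nonneg (hv σ) (hperm σ))

/-- If the diagonal of `w` vanishes and every permutation has nonnegative total weight, then `w`
admits a potential. -/
theorem exists_potential {ι : Type*} [Fintype ι] {w : ι → ι → ℝ}
    (hdiag : ∀ i, w i i = 0) (hperm : ∀ σ : Equiv.Perm ι, 0 ≤ ∑ i, w i (σ i)) :
    ∃ a : ι → ℝ, ∀ i j, a i ≤ a j + w i j := by
  classical
  cases isEmpty_or_nonempty ι with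
  | inl h => exact ⟨fun _ => 0, fun i => h.elim i⟩
  | inr h =>
  obtain ⟨r⟩ := h
  let cost : Matrix ι ι ℝ → ℝ := fun N => ∑ i, ∑ j, w i j * N i j
  have hcost : ∀ N i j, cost (N + Matrix.single i j 1) = cost N + w i j := fun N i j => by
    simp [cost, mul_add, Finset.sum_add_distrib, Matrix.single_apply, ite_and]
  let flows : ι → Set (Matrix ι ι ℝ) := fun i => {N | (∀ p q, 0 ≤ N p q) ∧
    ∀ p, (∑ q, N p q) + (if p = r then 1 else 0) = (∑ q, N q p) + (if p = i then 1 else 0)}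
  have hsingle : ∀ {N : Matrix ι ι ℝ} (i j : ι), (∀ p q, 0 ≤ N p q) →
      ∀ p q, 0 ≤ (N + Matrix.single i j 1 : Matrix ι ι ℝ) p q := fun i j hN p q => by
    rw [Matrix.add_apply, Matrix.single_apply]
    split_ifs <;> linarith [hN p q]
  have hrow : ∀ (N : Matrix ι ι ℝ) (i j p : ι),
      ∑ q, (N + Matrix.single i j 1 : Matrix ι ι ℝ) p q = (∑ q, N p q) + if p = i then 1 else 0 :=
    fun N i j p => by
      simp [Finset.sum_add_distrib, Matrix.single_apply, ite_and, eq_comm]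
  have hcol : ∀ (N : Matrix ι ι ℝ) (i j p : ι),
      ∑ q, (N + Matrix.single i j 1 : Matrix ι ι ℝ) q p = (∑ q, N q p) + if p = j then 1 else 0 :=
    fun N i j p => by
      simp [Finset.sum_add_distrib, Matrix.single_apply, ite_and, eq_comm]
  have hbdd : ∀ i, BddBelow (cost '' flows i) := fun i => by
    refine ⟨-w r i, ?_⟩
    rintro _ ⟨N, ⟨hN, hflow⟩, rfl⟩
    have := circulation_weight_nonneg hdiag hperm (hsingle r i hN) fun p => by
      rw [hrow, hcol, hflow]
    have h := hcost N r i
    simp only [cost] at h ⊢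
    linarith
  have hne : ∀ i, (flows i).Nonempty := fun i => by
    refine ⟨0 + Matrix.single i r 1, hsingle i r (by simp), fun p => ?_⟩
    rw [hrow, hcol]
    simp [add_comm]
  refine ⟨fun i => sInf (cost '' flows i), fun i j => ?_⟩
  rw [← sub_le_iff_le_add]
  refine le_csInf ((hne j).image _) ?_
  rintro _ ⟨N, ⟨hN, hflow⟩, rfl⟩
  rw [sub_le_iff_le_add, ← hcost]
  refine csInf_le (hbdd i) ⟨_, ⟨hsingle i j hN, fun p => ?_⟩, rfl⟩
  rw [hrow, hcol]
  linarith [hflow p]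

/-- If the identity matching of `x` with `z` is optimal, some `1`-Lipschitz function realizes every
distance `dist (x i) (z i)`. -/
theorem exists_lipschitz_dist_le_sub {X ι : Type*} [PseudoMetricSpace X] [Fintype ι] [Nonempty ι]
    {x z : ι → X}
    (hopt : ∀ σ : Equiv.Perm ι, ∑ i, dist (x i) (z i) ≤ ∑ i, dist (x i) (z (σ i))) :
    ∃ f : X → ℝ, LipschitzWith 1 f ∧ ∀ i, dist (x i) (z i) ≤ f (x i) - f (z i) := by
  obtain ⟨a, ha⟩ := exists_potential (w := fun i j => dist (x i) (z j) - dist (x i) (z i))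
    (fun i => sub_self _) fun σ => by
      rw [Finset.sum_sub_distrib]
      exact sub_nonneg.2 (hopt σ)
  have hle : ∀ p i, ⨅ j, (a j + dist p (z j)) ≤ a i + dist p (z i) := fun p i =>
    ciInf_le (Set.finite_range _).bddBelow i
  refine ⟨fun p => ⨅ j, (a j + dist p (z j)), LipschitzWith.of_le_add fun p q => ?_, fun i => ?_⟩
  · rw [← sub_le_iff_le_add]
    refine le_ciInf fun j => ?_
    linarith [hle p j, dist_triangle p q (z j)]
  · have hx : a i + dist (x i) (z i) ≤ ⨅ j, (a j + dist (x i) (z j)) :=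
      le_ciInf fun j => by linarith [ha i j]
    have hz := hle (z i) i
    rw [dist_self] at hz
    linarith

/-- Let `X` be a metric space, `k ≥ 1`, and `x₁,…,x_k`, `y₁,…,y_k` points
of `X`. Then the supremum over all `1`-Lipschitz `f : X → ℝ` of `∑ (f (x i) − f (y i))` is
attained and equals the minimum over all permutations `π` of `∑ dist (x i) (y (π i))`. -/
theorem stmt_2 (X : Type) [MetricSpace X] (k : ℕ) (hk : 1 ≤ k) (x y : Fin k → X) :
    ∃ W : ℝ,
      IsGreatest {s : ℝ | ∃ f : X → ℝ, LipschitzWith 1 f ∧ s = ∑ i, (f (x i) - f (y i))} W ∧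
      IsLeast {s : ℝ | ∃ π : Equiv.Perm (Fin k), s = ∑ i, dist (x i) (y (π i))} W := by
  have : Nonempty (Fin k) := ⟨⟨0, hk⟩⟩
  obtain ⟨π, hπ⟩ := Finite.exists_min fun π : Equiv.Perm (Fin k) => ∑ i, dist (x i) (y (π i))
  have hreindex : ∀ f : X → ℝ, ∑ i, (f (x i) - f (y i)) = ∑ i, (f (x i) - f (y (π i))) :=
    fun f => by
      rw [Finset.sum_sub_distrib, Finset.sum_sub_distrib, Equiv.sum_comp π fun i => f (y i)]
  have hub : ∀ f : X → ℝ, LipschitzWith 1 f →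
      ∑ i, (f (x i) - f (y i)) ≤ ∑ i, dist (x i) (y (π i)) := fun f hf => by
    rw [hreindex]
    refine Finset.sum_le_sum fun i _ => (le_abs_self _).trans ?_
    simpa [Real.dist_eq] using hf.dist_le_mul (x i) (y (π i))
  obtain ⟨f, hf, hfd⟩ := exists_lipschitz_dist_le_sub (x := x) (z := fun i => y (π i))
    fun σ => hπ (π * σ)
  refine ⟨∑ i, dist (x i) (y (π i)), ⟨⟨f, hf, ?_⟩, ?_⟩, ⟨π, rfl⟩, ?_⟩
  · refine le_antisymm ?_ (hub f hf)
    rw [hreindex]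
    exact Finset.sum_le_sum fun i _ => hfd i
  · rintro _ ⟨g, hg, rfl⟩
    exact hub g hg
  · rintro _ ⟨σ, rfl⟩
    exact hπ σ
end

section
/- Let X be a metric space, k ≥ 1, and let x₁,…,x_k and y₁,…,y_k be points of X. Set 𝒲 := sup{∑_{i=1}^k (f(x_i) − f(y_i)) : f : X → ℝ is 1-Lipschitz} and W := sup{∑_{i=1}^k (f(x_i) − f(y_i)) : f : X → ℝ is 1-Lipschitz and |f| ≤ 1 on X}. If W < 2, then 𝒲 = W. -/
open MeasureTheory Set in
/-- The distribution function of Lebesgue measure restricted to a set of finite measure is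
`1`-Lipschitz. -/
theorem lipschitzWith_volume_real_inter_Iic {A : Set ℝ} (hA : volume A ≠ ⊤) :
    LipschitzWith 1 fun s : ℝ => volume.real (A ∩ Iic s) := by
  refine LipschitzWith.of_le_add fun a b => ?_
  have hfin : volume (A ∩ Iic b ∪ Ioc b a) ≠ ⊤ :=
    measure_union_ne_top (measure_ne_top_of_subset inter_subset_left hA) measure_Ioc_lt_top.ne
  calc volume.real (A ∩ Iic a) ≤ volume.real (A ∩ Iic b ∪ Ioc b a) := by
        refine measureReal_mono (fun t ht => ?_) hfin
        rcases le_or_gt t b with h | h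
        · exact Or.inl ⟨ht.1, h⟩
        · exact Or.inr ⟨h, ht.2⟩
    _ ≤ volume.real (A ∩ Iic b) + volume.real (Ioc b a) := measureReal_union_le _ _
    _ ≤ volume.real (A ∩ Iic b) + dist a b := by
        rw [Real.volume_real_Ioc, Real.dist_eq]
        gcongr
        exact max_le (le_abs_self _) (abs_nonneg _)

/-- The difference of the numbers of indices `i` with `t ≤ u i` and with `t ≤ v i`. -/
noncomputable def countDiff {ι : Type*} [Fintype ι] (u v : ι → ℝ) (t : ℝ) : ℝ :=
  ∑ i, ((Set.Iic (u i)).indicator 1 t - (Set.Iic (v i)).indicator 1 t)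

theorem measurable_countDiff {ι : Type*} [Fintype ι] (u v : ι → ℝ) :
    Measurable (countDiff u v) :=
  Finset.measurable_fun_sum _ fun _ _ =>
    (measurable_one.indicator measurableSet_Iic).sub (measurable_one.indicator measurableSet_Iic)

theorem countDiff_nonpos_or_one_le {ι : Type*} [Fintype ι] (u v : ι → ℝ) (t : ℝ) :
    countDiff u v t ≤ 0 ∨ 1 ≤ countDiff u v t := by
  have h : ((∑ i, ((Set.Iic (u i)).indicator 1 t - (Set.Iic (v i)).indicator 1 t) : ℤ) : ℝ) =
      countDiff u v t := by
    simp [countDiff, Set.indicator_apply]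
  rw [← h]
  rcases le_or_gt (∑ i, ((Set.Iic (u i)).indicator 1 t - (Set.Iic (v i)).indicator 1 t) : ℤ) 0
    with h0 | h0
  · exact Or.inl (by exact_mod_cast h0)
  · exact Or.inr (by exact_mod_cast h0)

open MeasureTheory Set in
theorem integrableOn_indicator_Iic {A : Set ℝ} (hA : volume A ≠ ⊤) (s : ℝ) :
    IntegrableOn ((Iic s).indicator (1 : ℝ → ℝ)) A :=
  (integrableOn_const hA).indicator measurableSet_Iic

open MeasureTheory in
theorem integrableOn_countDiff {ι : Type*} [Fintype ι] (u v : ι → ℝ) {A : Set ℝ}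
    (hA : volume A ≠ ⊤) : IntegrableOn (countDiff u v) A :=
  integrable_finsetSum _ fun _ _ =>
    (integrableOn_indicator_Iic hA _).sub (integrableOn_indicator_Iic hA _)

open MeasureTheory Set in
theorem setIntegral_countDiff {ι : Type*} [Fintype ι] (u v : ι → ℝ) {A : Set ℝ}
    (hA : volume A ≠ ⊤) :
    ∫ t in A, countDiff u v t =
      ∑ i, (volume.real (A ∩ Iic (u i)) - volume.real (A ∩ Iic (v i))) := by
  have h (s : ℝ) : ∫ t in A, (Iic s).indicator (1 : ℝ → ℝ) t = volume.real (A ∩ Iic s) := by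
    rw [integral_indicator_one measurableSet_Iic, measureReal_restrict_apply measurableSet_Iic,
      inter_comm]
  unfold countDiff
  rw [integral_finsetSum]
  swap
  · exact fun i _ => (integrableOn_indicator_Iic hA (u i)).sub (integrableOn_indicator_Iic hA (v i))
  refine Finset.sum_congr rfl fun i _ => ?_
  rw [integral_sub (integrableOn_indicator_Iic hA _) (integrableOn_indicator_Iic hA _), h, h]

open MeasureTheory Set in
/-- If every `1`-Lipschitz function with values in `[-1, 1]` satisfies
`∑ i, (f (x i) - f (y i)) ≤ W` for some `W < 2`, then so does every `1`-Lipschitz function. -/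
theorem sum_sub_le_of_forall_abs_le_one {X ι : Type*} [PseudoMetricSpace X] [Fintype ι]
    (x y : ι → X) {W : ℝ} (hW : W < 2)
    (h : ∀ f : X → ℝ, LipschitzWith 1 f → (∀ z, |f z| ≤ 1) → ∑ i, (f (x i) - f (y i)) ≤ W)
    {f : X → ℝ} (hf : LipschitzWith 1 f) : ∑ i, (f (x i) - f (y i)) ≤ W := by
  set g := countDiff (f ∘ x) (f ∘ y) with hg
  have integral_le {A : Set ℝ} (hA : volume A ≠ ⊤) (hA2 : volume.real A ≤ 2) :
      ∫ t in A, g t ≤ W := by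
    rw [hg, setIntegral_countDiff _ _ hA]
    refine le_trans (le_of_eq ?_) (h (fun z => volume.real (A ∩ Iic (f z)) - 1) ?_ fun z => ?_)
    · simp
    · refine LipschitzWith.of_dist_le_mul fun a b => ?_
      rw [dist_sub_right]
      simpa using ((lipschitzWith_volume_real_inter_Iic hA).comp hf).dist_le_mul a b
    · have h0 : 0 ≤ volume.real (A ∩ Iic (f z)) := measureReal_nonneg
      have h2 : volume.real (A ∩ Iic (f z)) ≤ volume.real A :=
        measureReal_mono inter_subset_left hA
      rw [abs_le]
      constructor <;> linarith
  obtain ⟨m, hm⟩ := ((finite_range (f ∘ x)).union (finite_range (f ∘ y))).bddBelow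
  obtain ⟨M, hM⟩ := ((finite_range (f ∘ x)).union (finite_range (f ∘ y))).bddAbove
  have hfin : volume (Ioc m M) ≠ ⊤ := measure_Ioc_lt_top.ne
  set A := Ioc m M ∩ {t | 1 ≤ g t} with hA_def
  have hgm : MeasurableSet {t | 1 ≤ g t} :=
    measurableSet_le measurable_const (measurable_countDiff _ _)
  have hA : volume A ≠ ⊤ := measure_ne_top_of_subset inter_subset_left hfin
  have sum_le : ∑ i, (f (x i) - f (y i)) ≤ ∫ t in A, g t := by
    have key {s : ℝ} (hs : s ∈ range (f ∘ x) ∪ range (f ∘ y)) :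
        volume.real (Ioc m M ∩ Iic s) = s - m := by
      have : Ioc m M ∩ Iic s = Ioc m s := by
        rw [Ioc_inter_Iic, min_eq_right (hM hs)]
      rw [this, Real.volume_real_Ioc_of_le (hm hs)]
    calc ∑ i, (f (x i) - f (y i)) = ∫ t in Ioc m M, g t := by
          rw [hg, setIntegral_countDiff _ _ hfin]
          refine Finset.sum_congr rfl fun i _ => ?_
          rw [key (Or.inl ⟨i, rfl⟩), key (Or.inr ⟨i, rfl⟩)]
          simp
      _ ≤ ∫ t in Ioc m M, {t | 1 ≤ g t}.indicator g t := by
          refine integral_mono (integrableOn_countDiff _ _ hfin)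
            ((integrableOn_countDiff _ _ hfin).indicator hgm) fun t => ?_
          by_cases ht : t ∈ {t | 1 ≤ g t}
          · rw [indicator_of_mem ht]
          · rw [indicator_of_notMem ht]
            exact (countDiff_nonpos_or_one_le _ _ t).resolve_right ht
      _ = ∫ t in A, g t := by rw [setIntegral_indicator hgm]
  refine sum_le.trans ?_
  rcases le_or_gt (volume.real A) 2 with h2 | h2
  · exact integral_le hA h2
  exfalso
  have hmM : m ≤ M := by
    by_contra! hlt
    have : A = ∅ := by rw [hA_def, Ioc_eq_empty hlt.not_gt, empty_inter]
    simp [this] at h2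
    linarith
  have hφm : volume.real (A ∩ Iic m) = 0 := by
    have : A ∩ Iic m = ∅ := by
      ext t
      simp only [hA_def, mem_inter_iff, mem_Ioc, mem_Iic, mem_empty_iff_false, iff_false]
      rintro ⟨⟨⟨h1, -⟩, -⟩, h3⟩
      linarith
    simp [this]
  have hφM : A ∩ Iic M = A := inter_eq_left.2 fun t ht => ht.1.2
  obtain ⟨c, -, hc⟩ := intermediate_value_Icc hmM
    (lipschitzWith_volume_real_inter_Iic hA).continuous.continuousOn
    (show (2 : ℝ) ∈ Icc (volume.real (A ∩ Iic m)) (volume.real (A ∩ Iic M)) by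
      rw [hφm, hφM]
      exact ⟨by norm_num, h2.le⟩)
  replace hc : volume.real (A ∩ Iic c) = 2 := hc
  have hB : volume (A ∩ Iic c) ≠ ⊤ := measure_ne_top_of_subset inter_subset_left hA
  have hBm : MeasurableSet (A ∩ Iic c) := (measurableSet_Ioc.inter hgm).inter measurableSet_Iic
  have two_le : 2 ≤ ∫ t in A ∩ Iic c, g t := by
    calc (2 : ℝ) = ∫ _ in A ∩ Iic c, (1 : ℝ) := by simp [hc]
      _ ≤ ∫ t in A ∩ Iic c, g t :=
        setIntegral_mono_on (integrableOn_const hB) (integrableOn_countDiff _ _ hB) hBm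
          fun t ht => ht.1.2
  linarith [integral_le hB hc.le]

/-- Let `X` be a metric space, `k ≥ 1`, and `x₁,…,x_k`, `y₁,…,y_k` points
of `X`. Let `𝒲` be the supremum of `∑ (f (x i) − f (y i))` over all `1`-Lipschitz
`f : X → ℝ`, and `W` the supremum over all `1`-Lipschitz `f` with `|f| ≤ 1`.
If `W < 2`, then `𝒲 = W`. -/
theorem stmt_3 (X : Type) [MetricSpace X] (k : ℕ) (hk : 1 ≤ k) (x y : Fin k → X)
    (hW : sSup {s : ℝ | ∃ f : X → ℝ, LipschitzWith 1 f ∧ (∀ z, |f z| ≤ 1) ∧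
        s = ∑ i, (f (x i) - f (y i))} < 2) :
    sSup {s : ℝ | ∃ f : X → ℝ, LipschitzWith 1 f ∧ s = ∑ i, (f (x i) - f (y i))} =
      sSup {s : ℝ | ∃ f : X → ℝ, LipschitzWith 1 f ∧ (∀ z, |f z| ≤ 1) ∧
        s = ∑ i, (f (x i) - f (y i))} := by
  have hbdd : BddAbove {s : ℝ | ∃ f : X → ℝ, LipschitzWith 1 f ∧ (∀ z, |f z| ≤ 1) ∧
      s = ∑ i, (f (x i) - f (y i))} := by
    refine ⟨∑ _i : Fin k, 2, ?_⟩
    rintro _ ⟨f, -, hf, rfl⟩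
    refine Finset.sum_le_sum fun i _ => ?_
    linarith [(abs_le.1 (hf (x i))).2, (abs_le.1 (hf (y i))).1]
  have hle : ∀ s ∈ {s : ℝ | ∃ f : X → ℝ, LipschitzWith 1 f ∧ s = ∑ i, (f (x i) - f (y i))},
      s ≤ sSup {s : ℝ | ∃ f : X → ℝ, LipschitzWith 1 f ∧ (∀ z, |f z| ≤ 1) ∧
        s = ∑ i, (f (x i) - f (y i))} := by
    rintro _ ⟨f, hf, rfl⟩
    exact sum_sub_le_of_forall_abs_le_one x y hW
      (fun f hf hf1 => le_csSup hbdd ⟨f, hf, hf1, rfl⟩) hf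
  have hzero : LipschitzWith 1 (fun _ : X => (0 : ℝ)) := LipschitzWith.const' 0
  refine le_antisymm (csSup_le ⟨_, _, hzero, rfl⟩ hle) ?_
  refine csSup_le_csSup ⟨_, hle⟩ ⟨_, _, hzero, by simp, rfl⟩ ?_
  rintro _ ⟨f, hf, -, rfl⟩
  exact ⟨f, hf, rfl⟩
end

section
/- Let (X,d) be a metric space, let x₁,…,x_k, y₁,…,y_k ∈ X, and let δ := min{d, 2}, which is again a metric on X. Then sup{∑_{i=1}^k (f(x_i) − f(y_i)) : f : X → ℝ is 1-Lipschitz with respect to δ} = sup{∑_{i=1}^k (f(x_i) − f(y_i)) : f : X → ℝ is 1-Lipschitz with respect to d and |f| ≤ 1 on X}. -/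
/-- A real function of oscillation at most `2` takes values in a closed interval of radius `1`. -/
theorem exists_abs_sub_le_one_of_abs_sub_le_two {X : Type*} {f : X → ℝ}
    (hf : ∀ p q, |f p - f q| ≤ 2) : ∃ c : ℝ, ∀ z, |f z - c| ≤ 1 := by
  refine ⟨(⨆ z, f z) - 1, fun z => ?_⟩
  have : Nonempty X := ⟨z⟩
  have hle : ∀ p, f p ≤ f z + 2 := fun p => by linarith [le_of_abs_le (hf p z)]
  have hbdd : BddAbove (Set.range f) := ⟨f z + 2, Set.forall_mem_range.2 hle⟩
  have hlower := le_ciSup hbdd z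
  have hupper := ciSup_le hle
  rw [abs_le]
  constructor <;> linarith

/-- Let `(X,d)` be a metric space, `x₁,…,x_k, y₁,…,y_k ∈ X`, and let
`δ := min {d, 2}` (again a metric on `X`). Then the supremum of `∑ (f (x i) − f (y i))` over
all functions `f : X → ℝ` that are `1`-Lipschitz with respect to `δ` equals the supremum over
all `f` that are `1`-Lipschitz with respect to `d` and satisfy `|f| ≤ 1` on `X`. -/
theorem stmt_4 (X : Type) [MetricSpace X] (k : ℕ) (x y : Fin k → X) :
    sSup {s : ℝ | ∃ f : X → ℝ, (∀ p q : X, |f p - f q| ≤ min (dist p q) 2) ∧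
        s = ∑ i, (f (x i) - f (y i))} =
      sSup {s : ℝ | ∃ f : X → ℝ, (∀ p q : X, |f p - f q| ≤ dist p q) ∧ (∀ z, |f z| ≤ 1) ∧
        s = ∑ i, (f (x i) - f (y i))} := by
  congr 1
  ext s
  constructor
  · rintro ⟨f, hf, rfl⟩
    obtain ⟨c, hc⟩ :=
      exists_abs_sub_le_one_of_abs_sub_le_two fun p q => (hf p q).trans (min_le_right _ _)
    exact ⟨fun z => f z - c, fun p q => by simpa using (hf p q).trans (min_le_left _ _), hc,
      by simp⟩
  · rintro ⟨f, hf, hb, rfl⟩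
    refine ⟨f, fun p q => le_min (hf p q) ?_, rfl⟩
    linarith [abs_sub (f p) (f q), hb p, hb q]
end

section
/- Let c > 0 and let X be a metric space in which every pair of points p, q can be joined by a continuous curve of length at most c·d(p,q). Then for any points x₁,…,x_k, y₁,…,y_k ∈ X there exist a permutation π of {1,…,k} and continuous paths γ_i : [0,1] → X with γ_i(0) = x_i and γ_i(1) = y_{π(i)} such that the sum of the lengths of the γ_i is at most c·𝒲, where 𝒲 := sup{∑_{i=1}^k (f(x_i) − f(y_i)) : f : X → ℝ is 1-Lipschitz}. -/
/-- Among the 1-Lipschitz functions on a nonempty metric space, one maximises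
`∑ i, (f (x i) - f (y i))`. -/
theorem exists_lipschitz_max_sum_sub {X ι : Type*} [PseudoMetricSpace X] [Nonempty X] [Fintype ι]
    (x y : ι → X) :
    ∃ f : X → ℝ, LipschitzWith 1 f ∧ ∀ g : X → ℝ, LipschitzWith 1 g →
      ∑ i, (g (x i) - g (y i)) ≤ ∑ i, (f (x i) - f (y i)) := by
  obtain ⟨p⟩ := ‹Nonempty X›
  let K : Set (X → ℝ) := {f | f p = 0 ∧ ∀ a b, f a ≤ f b + dist a b}
  have hK : IsCompact K := by
    refine (isCompact_univ_pi fun z : X => isCompact_Icc (a := -dist p z) (b := dist z p)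
      ).of_isClosed_subset ?_ ?_
    · simp only [K, Set.ofPred_and, Set.ofPred_forall]
      refine (isClosed_eq (continuous_apply p) continuous_const).inter
        (isClosed_iInter fun a => isClosed_iInter fun b => isClosed_le (continuous_apply a)
          ((continuous_apply b).add continuous_const))
    · rintro f ⟨h0, hf⟩ z -
      have h1 := hf z p
      have h2 := hf p z
      constructor <;> linarith
  have hne : K.Nonempty := ⟨0, rfl, fun a b => by simp⟩
  have hcont : Continuous fun f : X → ℝ => ∑ i, (f (x i) - f (y i)) := by fun_prop
  obtain ⟨f, hfK, hmax⟩ := hK.exists_isMaxOn hne hcont.continuousOn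
  refine ⟨f, LipschitzWith.of_le_add hfK.2, fun g hg => ?_⟩
  have hgK : (fun z => g z - g p) ∈ K := by
    refine ⟨sub_self _, fun a b => ?_⟩
    have := hg.le_add_mul a b
    simp only [NNReal.coe_one, one_mul] at this
    linarith
  have h := isMaxOn_iff.1 hmax _ hgK
  simpa only [sub_sub_sub_cancel_right] using h

/-- The infimal convolution of finitely many values with the distance turns an admissible pair of
potentials `u i - v j ≤ dist (x i) (y j)` into a 1-Lipschitz function which is at least as good. -/
theorem exists_lipschitz_of_sub_le_dist {X ι κ : Type*} [PseudoMetricSpace X] [Fintype κ]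
    [Nonempty κ] (x : ι → X) (y : κ → X) (u : ι → ℝ) (v : κ → ℝ)
    (huv : ∀ i j, u i - v j ≤ dist (x i) (y j)) :
    ∃ g : X → ℝ, LipschitzWith 1 g ∧ (∀ i, u i ≤ g (x i)) ∧ ∀ j, g (y j) ≤ v j := by
  have hle : ∀ z j, Finset.univ.inf' Finset.univ_nonempty (fun j => v j + dist z (y j)) ≤
      v j + dist z (y j) := fun z j =>
    Finset.inf'_le (fun j => v j + dist z (y j)) (Finset.mem_univ j)
  refine ⟨fun z => Finset.univ.inf' Finset.univ_nonempty fun j => v j + dist z (y j),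
    LipschitzWith.of_le_add fun a b => ?_, fun i => ?_, fun j => ?_⟩
  · obtain ⟨j, -, hj⟩ := Finset.exists_mem_eq_inf' (Finset.univ_nonempty (α := κ))
      fun j => v j + dist b (y j)
    rw [hj]
    linarith [hle a j, dist_triangle a b (y j)]
  · refine Finset.le_inf' _ _ fun j _ => ?_
    linarith [huv i j]
  · simpa using hle (y j) j

open Filter Topology in
/-- **Kantorovich duality** for finitely many points of equal weight: some permutation matches the
points at total cost equal to the value of an optimal 1-Lipschitz function. -/
theorem exists_perm_sum_dist_eq {X ι : Type*} [PseudoMetricSpace X] [Fintype ι] [Nonempty ι]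
    (x y : ι → X) :
    ∃ (π : Equiv.Perm ι) (f : X → ℝ), LipschitzWith 1 f ∧
      ∑ i, dist (x i) (y (π i)) = ∑ i, (f (x i) - f (y i)) := by
  classical
  have : Nonempty X := ‹Nonempty ι›.map x
  obtain ⟨f, hf, hmax⟩ := exists_lipschitz_max_sum_sub x y
  have hfd : ∀ i j, f (x i) - f (y j) ≤ dist (x i) (y j) := fun i j => by
    have := hf.le_add_mul (x i) (y j)
    simp only [NNReal.coe_one, one_mul] at this
    linarith
  let t : ι → Finset ι := fun i => {j | f (x i) - f (y j) = dist (x i) (y j)}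
  have hall : ∀ s : Finset ι, s.card ≤ (s.biUnion t).card := by
    intro s
    by_contra! hlt
    have hev : ∀ᶠ ε : ℝ in 𝓝[>] 0, ∀ i j, i ∈ s → j ∉ s.biUnion t →
        ε ≤ dist (x i) (y j) - (f (x i) - f (y j)) := by
      refine eventually_all.2 fun i => eventually_all.2 fun j => ?_
      by_cases h : i ∈ s ∧ j ∉ s.biUnion t
      · have hpos : 0 < dist (x i) (y j) - (f (x i) - f (y j)) := by
          refine sub_pos.2 (lt_of_le_of_ne (hfd i j) fun he => h.2 ?_)
          exact Finset.mem_biUnion.2 ⟨i, h.1, by simpa [t] using he⟩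
        filter_upwards [nhdsWithin_le_nhds (eventually_le_nhds hpos)] with ε hε _ _ using hε
      · exact Eventually.of_forall fun ε hi hj => absurd ⟨hi, hj⟩ h
    obtain ⟨ε, hε, hpos⟩ := (hev.and self_mem_nhdsWithin).exists
    obtain ⟨g, hg, hgx, hgy⟩ := exists_lipschitz_of_sub_le_dist x y
      (fun i => f (x i) + if i ∈ s then ε else 0)
      (fun j => f (y j) + if j ∈ s.biUnion t then ε else 0) (fun i j => by
        have h1 := hfd i j
        have h2 := hε i j
        split_ifs with hi hj hj
        · linarith
        · linarith [h2 hi hj]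
        · linarith
        · linarith)
    have hsum : ∑ i, ((f (x i) + if i ∈ s then ε else 0) -
        (f (y i) + if i ∈ s.biUnion t then ε else 0)) ≤ ∑ i, (f (x i) - f (y i)) :=
      (Finset.sum_le_sum fun i _ => sub_le_sub (hgx i) (hgy i)).trans (hmax g hg)
    simp only [Finset.sum_sub_distrib, Finset.sum_add_distrib, Finset.sum_ite_mem,
      Finset.univ_inter, Finset.sum_const, nsmul_eq_mul] at hsum
    have hcard : ((s.biUnion t).card : ℝ) < s.card := by exact_mod_cast hlt
    nlinarith
  obtain ⟨π, hinj, hπ⟩ := (Finset.all_card_le_biUnion_card_iff_exists_injective t).1 hall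
  refine ⟨Equiv.ofBijective π (Finite.injective_iff_bijective.1 hinj), f, hf, ?_⟩
  have hval : ∀ i, dist (x i) (y (π i)) = f (x i) - f (y (π i)) := fun i => by
    simpa [t, eq_comm] using hπ i
  simp only [Equiv.ofBijective_apply, hval, Finset.sum_sub_distrib]
  congr 1
  exact (Equiv.ofBijective π (Finite.injective_iff_bijective.1 hinj)).sum_comp fun j => f (y j)


/-- Let `c > 0` and let `X` be a metric space in which any two points `p, q`
can be joined by a continuous curve of length (total variation) at most `c · dist p q`. Then
for all points `x₁,…,x_k, y₁,…,y_k ∈ X` there exist a permutation `π` of `{1,…,k}` and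
continuous paths `γ i` from `x i` to `y (π i)` whose total length is at most `c · 𝒲`, where
`𝒲 := sup {∑ (f (x i) − f (y i)) : f : X → ℝ is 1-Lipschitz}`. -/
theorem stmt_5 (X : Type) [MetricSpace X] (c : ℝ) (hc : 0 < c)
    (hconn : ∀ p q : X, ∃ γ : ℝ → X, ContinuousOn γ (Set.Icc 0 1) ∧ γ 0 = p ∧ γ 1 = q ∧
      eVariationOn γ (Set.Icc 0 1) ≤ ENNReal.ofReal (c * dist p q))
    (k : ℕ) (x y : Fin k → X) :
    ∃ (π : Equiv.Perm (Fin k)) (γ : Fin k → ℝ → X),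
      (∀ i, ContinuousOn (γ i) (Set.Icc 0 1) ∧ γ i 0 = x i ∧ γ i 1 = y (π i)) ∧
      ∑ i, eVariationOn (γ i) (Set.Icc 0 1) ≤
        ENNReal.ofReal (c * sSup {s : ℝ | ∃ f : X → ℝ, LipschitzWith 1 f ∧
          s = ∑ i, (f (x i) - f (y i))}) := by
  rcases isEmpty_or_nonempty (Fin k) with h | h
  · exact ⟨1, fun i => h.elim i, fun i => h.elim i, by simp⟩
  obtain ⟨π, f, hf, hπ⟩ := exists_perm_sum_dist_eq x y
  choose γ hγ h0 h1 hlen using hconn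
  refine ⟨π, fun i => γ (x i) (y (π i)), fun i => ⟨hγ _ _, h0 _ _, h1 _ _⟩, ?_⟩
  have hbdd : BddAbove {s : ℝ | ∃ f : X → ℝ, LipschitzWith 1 f ∧
      s = ∑ i, (f (x i) - f (y i))} := by
    refine ⟨∑ i, dist (x i) (y i), ?_⟩
    rintro _ ⟨g, hg, rfl⟩
    refine Finset.sum_le_sum fun i _ => ?_
    have := hg.le_add_mul (x i) (y i)
    simp only [NNReal.coe_one, one_mul] at this
    linarith
  calc ∑ i, eVariationOn (γ (x i) (y (π i))) (Set.Icc 0 1)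
      ≤ ∑ i, ENNReal.ofReal (c * dist (x i) (y (π i))) := Finset.sum_le_sum fun i _ => hlen _ _
    _ = ENNReal.ofReal (c * ∑ i, dist (x i) (y (π i))) := by
      rw [Finset.mul_sum, ENNReal.ofReal_sum_of_nonneg fun i _ => by positivity]
    _ ≤ _ := by
      refine ENNReal.ofReal_le_ofReal (mul_le_mul_of_nonneg_left ?_ hc.le)
      exact le_csSup hbdd ⟨f, hf, hπ⟩
end

section
/- For all n ≥ 1 and L ≥ 1 there exist constants L̄ ≥ 1 and N ≥ 0, depending only on n and L, with the following property: for every metric space X, every a ≥ 0, every nonempty subset W ⊆ ℝ^n, and every (L,a)-quasi-isometric embedding f : W → X, there exists an L̄-Lipschitz map f̄ : X → ℝ^n such that ‖f̄(f(x)) − x‖ ≤ N·a for all x ∈ W. -/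
/-- McShane-type extension with additive error: a real function `φ` on `ι` that is coarsely
`L`-Lipschitz with respect to `f : ι → X` is, up to the error `b`, the pull-back along `f` of an
`L`-Lipschitz function on `X`. -/
theorem exists_lipschitz_near_of_coarse_lipschitz {ι X : Type*} [Nonempty ι]
    [PseudoMetricSpace X] {L b : ℝ} (hL : 0 ≤ L) (f : ι → X) (φ : ι → ℝ)
    (h : ∀ p q, φ p - φ q ≤ L * dist (f p) (f q) + b) :
    ∃ g : X → ℝ, (∀ u v, |g u - g v| ≤ L * dist u v) ∧ ∀ p, |g (f p) - φ p| ≤ |b| := by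
  have hbdd : ∀ u, BddBelow (Set.range fun q => φ q + L * dist u (f q)) := by
    intro u
    obtain ⟨p⟩ := ‹Nonempty ι›
    refine ⟨φ p - L * dist (f p) u - b, ?_⟩
    rintro _ ⟨q, rfl⟩
    have := mul_le_mul_of_nonneg_left (dist_triangle (f p) u (f q)) hL
    have := h p q
    dsimp only
    linarith
  have hle : ∀ u v, (⨅ q, (φ q + L * dist u (f q))) - (⨅ q, (φ q + L * dist v (f q)))
      ≤ L * dist u v := by
    intro u v
    rw [sub_le_comm]
    refine le_ciInf fun q => ?_
    have h₁ := ciInf_le (hbdd u) q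
    have h₂ := mul_le_mul_of_nonneg_left (dist_triangle u v (f q)) hL
    linarith
  refine ⟨fun u => ⨅ q, (φ q + L * dist u (f q)), fun u v => ?_, fun p => ?_⟩
  · refine abs_sub_le_iff.2 ⟨hle u v, ?_⟩
    rw [dist_comm u v]
    exact hle v u
  · have hupper := ciInf_le (hbdd (f p)) p
    have hlower : φ p - b ≤ ⨅ q, (φ q + L * dist (f p) (f q)) :=
      le_ciInf fun q => by linarith [h p q]
    simp only [dist_self, mul_zero, add_zero] at hupper
    exact abs_sub_le_iff.2 ⟨by linarith [abs_nonneg b], by linarith [le_abs_self b]⟩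

theorem EuclideanSpace.norm_le_sqrt_card_mul {ι : Type*} [Fintype ι] {x : EuclideanSpace ℝ ι}
    {C : ℝ} (hC : 0 ≤ C) (h : ∀ i, |x i| ≤ C) : ‖x‖ ≤ √(Fintype.card ι) * C := by
  rw [EuclideanSpace.norm_eq, Real.sqrt_le_left (by positivity), mul_pow,
    Real.sq_sqrt (Nat.cast_nonneg _)]
  calc ∑ i, ‖x i‖ ^ 2 ≤ ∑ _i : ι, C ^ 2 :=
        Finset.sum_le_sum fun i _ => pow_le_pow_left₀ (norm_nonneg _) (h i) 2
    _ = Fintype.card ι * C ^ 2 := by simp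

/-- For all `n ≥ 1` and `L ≥ 1` there exist constants `L̄ ≥ 1` and `N ≥ 0`,
depending only on `n` and `L`, such that: for every metric space `X`, every `a ≥ 0`, every
nonempty subset `W ⊆ ℝ^n`, and every `(L,a)`-quasi-isometric embedding `f : W → X`, there is
an `L̄`-Lipschitz map `f̄ : X → ℝ^n` with `‖f̄ (f x) − x‖ ≤ N·a` for all `x ∈ W`. -/
theorem stmt_7 (n : ℕ) (hn : 1 ≤ n) (L : ℝ) (hL : 1 ≤ L) :
    ∃ Lbar N : ℝ, 1 ≤ Lbar ∧ 0 ≤ N ∧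
      ∀ (X : Type) [MetricSpace X], ∀ a : ℝ, 0 ≤ a →
        ∀ W : Set (EuclideanSpace ℝ (Fin n)), W.Nonempty →
          ∀ f : W → X,
            (∀ p q : W, L⁻¹ * dist p q - a ≤ dist (f p) (f q) ∧
              dist (f p) (f q) ≤ L * dist p q + a) →
            ∃ fbar : X → EuclideanSpace ℝ (Fin n),
              (∀ u v : X, dist (fbar u) (fbar v) ≤ Lbar * dist u v) ∧
              ∀ p : W, ‖fbar (f p) - (p : EuclideanSpace ℝ (Fin n))‖ ≤ N * a := by
  have hL0 : 0 < L := by linarith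
  refine ⟨√n * L, √n * L, ?_, by positivity, ?_⟩
  · have : (1 : ℝ) ≤ √n := Real.one_le_sqrt.2 (by exact_mod_cast hn)
    nlinarith
  intro X _ a ha W hW f hf
  have : Nonempty W := hW.to_subtype
  have hcoord : ∀ (i : Fin n) (p q : W),
      (p : EuclideanSpace ℝ (Fin n)) i - (q : EuclideanSpace ℝ (Fin n)) i
        ≤ L * dist (f p) (f q) + L * a := by
    intro i p q
    have h₁ := PiLp.norm_apply_le (p.1 - q.1) i
    rw [← dist_eq_norm, ← Subtype.dist_eq, PiLp.sub_apply, Real.norm_eq_abs] at h₁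
    have h₂ : L⁻¹ * dist p q ≤ dist (f p) (f q) + a := by linarith [(hf p q).1]
    rw [inv_mul_le_iff₀ hL0] at h₂
    linarith [le_abs_self ((p : EuclideanSpace ℝ (Fin n)) i - (q : EuclideanSpace ℝ (Fin n)) i)]
  choose g hg hgf using fun i => exists_lipschitz_near_of_coarse_lipschitz hL0.le f
    (fun p : W => (p : EuclideanSpace ℝ (Fin n)) i) (hcoord i)
  refine ⟨fun u => WithLp.toLp 2 fun i => g i u, fun u v => ?_, fun p => ?_⟩
  · rw [dist_eq_norm, mul_assoc]
    simpa using EuclideanSpace.norm_le_sqrt_card_mul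
      (x := WithLp.toLp 2 (fun i => g i u) - WithLp.toLp 2 (fun i => g i v))
      (by positivity) fun i => hg i u v
  · rw [mul_assoc]
    have hLa : 0 ≤ L * a := by positivity
    simpa using EuclideanSpace.norm_le_sqrt_card_mul
      (x := WithLp.toLp 2 (fun i => g i (f p)) - (p : EuclideanSpace ℝ (Fin n)))
      hLa fun i => (hgf i p).trans_eq (abs_of_nonneg hLa)
end

section
/- Let n ≥ 1 and let (X_i, d_i), i ∈ ℕ, be a sequence of metric spaces. Suppose that there exist L ≥ 1, a compact set K ⊆ ℝ^{n+1} of positive Lebesgue measure, a metric space Ω, an L-bi-Lipschitz homeomorphism φ : K → Ω, positive reals r_i → ∞ and δ_i → 0, and maps h_i : Ω → X_i that are (1,δ_i)-quasi-isometric embeddings with respect to the rescaled metric (1/r_i)·d_i on X_i. Then, with B denoting the closed unit ball of ℝ^{n+1}, there exist indices i(k) ∈ ℕ, reals s_k → ∞ and ε_k → 0, and maps f_k : s_k·B → X_{i(k)} that are (L, ε_k·s_k)-quasi-isometric embeddings with respect to the original metric d_{i(k)}, where s_k·B = {s_k·z : z ∈ B} carries the Euclidean metric. -/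
open Filter

/-- If `D / R` is `δ`-close to `d`, `d` is `L`-comparable to `e`, and `e` is `2 * η * ρ`-close to
`m / R`, where `δ ≤ ρ * η`, then `D` is `L`-comparable to `m` up to an error of size
`(2 * L + 1) * η * (ρ * R)`. -/
theorem rescaled_quasi_isometry_bounds {L R ρ η δ m e d D : ℝ} (hL : 1 ≤ L) (hR : 0 < R)
    (hlo : R⁻¹ * m - 2 * (η * ρ) ≤ e) (hup : e ≤ R⁻¹ * m + 2 * (η * ρ))
    (hdl : L⁻¹ * e ≤ d) (hdu : d ≤ L * e) (hDl : (d - δ) * R ≤ D) (hDu : D ≤ (d + δ) * R)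
    (hδ : δ ≤ ρ * η) :
    L⁻¹ * m - (2 * L + 1) * η * (ρ * R) ≤ D ∧ D ≤ L * m + (2 * L + 1) * η * (ρ * R) := by
  have hL0 : 0 < L := by linarith
  have hηρ : 0 ≤ η * ρ := by linarith
  have hLinv : L⁻¹ ≤ L := (inv_le_one_of_one_le₀ hL).trans hL
  constructor
  · have hd : L⁻¹ * (R⁻¹ * m) - 2 * L * (η * ρ) ≤ d := by
      have h₁ := mul_le_mul_of_nonneg_left hlo (inv_nonneg.2 hL0.le)
      have h₂ := mul_le_mul_of_nonneg_right hLinv hηρ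
      linarith
    calc L⁻¹ * m - (2 * L + 1) * η * (ρ * R)
        = (L⁻¹ * (R⁻¹ * m) - 2 * L * (η * ρ) - ρ * η) * R := by field_simp; ring
      _ ≤ (d - δ) * R := by gcongr
      _ ≤ D := hDl
  · calc D ≤ (d + δ) * R := hDu
      _ ≤ (L * (R⁻¹ * m + 2 * (η * ρ)) + ρ * η) * R := by
        gcongr
        exact hdu.trans (by gcongr)
      _ = L * m + (2 * L + 1) * η * (ρ * R) := by field_simp; ring

open MeasureTheory Metric Topology in
/-- A set of positive measure is, near a density point `x`, relatively dense in small balls: for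
each `η > 0`, all sufficiently small balls `closedBall x ρ` lie in the `η * ρ`-neighbourhood of the
set. -/
theorem exists_forall_eventually_exists_dist_le {E : Type*} [NormedAddCommGroup E]
    [NormedSpace ℝ E] [FiniteDimensional ℝ E] [MeasurableSpace E] [BorelSpace E]
    (μ : Measure E) [μ.IsAddHaarMeasure] {K : Set E} (hK : 0 < μ K) :
    ∃ x : E, ∀ η : ℝ, 0 < η → ∀ᶠ ρ in 𝓝[>] (0 : ℝ),
      ∀ y ∈ closedBall x ρ, ∃ z ∈ K, dist y z ≤ η * ρ := by
  have : NeZero (μ.restrict K) := ⟨by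
    rw [Ne, Measure.restrict_eq_zero]
    exact hK.ne'⟩
  obtain ⟨x, hx⟩ := (Besicovitch.ae_tendsto_measure_inter_div μ K).exists
  refine ⟨x, fun η hη => ?_⟩
  wlog hη1 : η ≤ 1 generalizing η
  · filter_upwards [this 1 one_pos le_rfl, self_mem_nhdsWithin] with ρ h (hρ : 0 < ρ) y hy
    obtain ⟨z, hz, hyz⟩ := h y hy
    exact ⟨z, hz, hyz.trans (by gcongr; exact (not_le.1 hη1).le)⟩
  set t : ℝ := (η / 2) ^ Module.finrank ℝ E with ht
  have ht0 : 0 < t := by positivity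
  have hscale : Tendsto (fun ρ : ℝ => 2 * ρ) (𝓝[>] 0) (𝓝[>] 0) := by
    refine tendsto_nhdsWithin_iff.2 ⟨?_, ?_⟩
    · exact ((continuous_const_mul (2 : ℝ)).tendsto' 0 0 (by simp)).mono_left nhdsWithin_le_nhds
    · filter_upwards [self_mem_nhdsWithin] with ρ (hρ : 0 < ρ)
      exact mul_pos two_pos hρ
  have hlt : ENNReal.ofReal (1 - t) < 1 := by
    rw [← ENNReal.ofReal_one]
    exact (ENNReal.ofReal_lt_ofReal_iff one_pos).2 (by linarith)
  filter_upwards [(hx.comp hscale).eventually (lt_mem_nhds hlt), self_mem_nhdsWithin] with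
    ρ hρK (hρ : 0 < ρ) y hy
  by_contra! hfar
  refine hρK.not_ge ?_
  set b := μ (closedBall x (2 * ρ)) with hb
  have hb_top : b ≠ ⊤ := measure_closedBall_lt_top.ne
  have hball : μ (closedBall y (η * ρ)) = ENNReal.ofReal t * b := by
    rw [hb, Measure.addHaar_closedBall μ _ (by positivity),
      Measure.addHaar_closedBall μ _ (by positivity), ← mul_assoc,
      ← ENNReal.ofReal_mul ht0.le, ht, ← mul_pow]
    rw [show η / 2 * (2 * ρ) = η * ρ by ring]
  have hsub : closedBall y (η * ρ) ⊆ closedBall x (2 * ρ) := by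
    refine closedBall_subset_closedBall' ?_
    have := mem_closedBall.1 hy
    nlinarith
  have hle : μ (K ∩ closedBall x (2 * ρ)) ≤ b - ENNReal.ofReal t * b := by
    rw [← hball, hb, ← measure_sdiff hsub measurableSet_closedBall.nullMeasurableSet
      measure_closedBall_lt_top.ne]
    refine measure_mono fun z hz => ⟨hz.2, fun hzy => ?_⟩
    exact (hfar z hz.1).not_ge (by rw [dist_comm]; exact mem_closedBall.1 hzy)
  refine ENNReal.div_le_of_le_mul (hle.trans_eq ?_)
  rw [ENNReal.ofReal_sub _ ht0.le, ENNReal.ofReal_one, ENNReal.sub_mul fun _ _ => hb_top, one_mul]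

/-- Let `n ≥ 1` and `(X i, d i)` a sequence of metric spaces. Suppose there
are `L ≥ 1`, a compact set `K ⊆ ℝ^{n+1}` of positive measure, a metric space `Ω`, an
`L`-bi-Lipschitz homeomorphism `φ : K → Ω`, positive reals `r i → ∞`, `δ i → 0`, and maps
`h i : Ω → X i` that are `(1, δ i)`-quasi-isometric embeddings for the rescaled metric
`(1/r i)·d i`. Then, with `B` the closed unit ball of `ℝ^{n+1}`, there exist indices
`idx k`, reals `s k → ∞` and `ε k → 0`, and maps `f k : s k · B → X (idx k)` that are
`(L, ε k · s k)`-quasi-isometric embeddings for the original metric. -/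
theorem stmt_8 (n : ℕ) (hn : 1 ≤ n) (X : ℕ → Type) (inst : ∀ i, MetricSpace (X i))
    (L : ℝ) (hL : 1 ≤ L)
    (K : Set (EuclideanSpace ℝ (Fin (n + 1)))) (hKcpt : IsCompact K)
    (hKpos : 0 < MeasureTheory.volume K)
    (Ω : Type) [MetricSpace Ω] (φ : K → Ω)
    (hφbij : Function.Bijective φ)
    (hφ : ∀ p q : K, L⁻¹ * dist p q ≤ dist (φ p) (φ q) ∧ dist (φ p) (φ q) ≤ L * dist p q)
    (r δ : ℕ → ℝ) (hr : ∀ i, 0 < r i) (hδ : ∀ i, 0 < δ i)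
    (hrt : Tendsto r atTop atTop) (hδt : Tendsto δ atTop (nhds 0))
    (h : ∀ i, Ω → X i)
    (hqi : ∀ i, ∀ p q : Ω,
      dist p q - δ i ≤ dist (h i p) (h i q) / r i ∧ dist (h i p) (h i q) / r i ≤ dist p q + δ i) :
    ∃ (idx : ℕ → ℕ) (s ε : ℕ → ℝ)
      (f : ∀ k, (Metric.closedBall (0 : EuclideanSpace ℝ (Fin (n + 1))) (s k)) → X (idx k)),
      Tendsto s atTop atTop ∧ Tendsto ε atTop (nhds 0) ∧
      (∀ k, 0 < s k) ∧ (∀ k, 0 ≤ ε k) ∧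
      ∀ k, ∀ p q : Metric.closedBall (0 : EuclideanSpace ℝ (Fin (n + 1))) (s k),
        L⁻¹ * dist p q - ε k * s k ≤ dist (f k p) (f k q) ∧
          dist (f k p) (f k q) ≤ L * dist p q + ε k * s k := by
  obtain ⟨x, hx⟩ := exists_forall_eventually_exists_dist_le MeasureTheory.volume hKpos
  have hL0 : 0 < L := by linarith
  have hη (k : ℕ) : (0 : ℝ) < 1 / ((k : ℝ) + 1) := by positivity
  have hρ (k : ℕ) := ((hx _ (hη k)).and self_mem_nhdsWithin).exists
  choose ρ hρK hρ0 using hρ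
  replace hρ0 (k : ℕ) : 0 < ρ k := hρ0 k
  have hidx (k : ℕ) : ∃ i, (k : ℝ) + 1 ≤ ρ k * r i ∧ δ i ≤ ρ k * (1 / ((k : ℝ) + 1)) :=
    (((hrt.const_mul_atTop (hρ0 k)).eventually_ge_atTop _).and
      (hδt.eventually_le_const (mul_pos (hρ0 k) (hη k)))).exists
  choose idx hidx_r hidx_δ using hidx
  have hnear (k : ℕ) (p : Metric.closedBall (0 : EuclideanSpace ℝ (Fin (n + 1)))
      (ρ k * r (idx k))) :
      ∃ z : K, dist (x + (r (idx k))⁻¹ • p.1) z ≤ 1 / ((k : ℝ) + 1) * ρ k := by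
    obtain ⟨z, hz, hpz⟩ := hρK k (x + (r (idx k))⁻¹ • p.1) (by
      have hp := mem_closedBall_zero_iff.1 p.2
      have := hr (idx k)
      rw [mem_closedBall_iff_norm, add_sub_cancel_left, norm_smul, norm_inv, Real.norm_eq_abs,
        abs_of_pos this, inv_mul_le_iff₀ this]
      linarith)
    exact ⟨⟨z, hz⟩, hpz⟩
  choose g hg using hnear
  refine ⟨idx, fun k => ρ k * r (idx k), fun k => (2 * L + 1) * (1 / ((k : ℝ) + 1)),
    fun k p => h (idx k) (φ (g k p)), ?_, ?_, fun k => mul_pos (hρ0 k) (hr _),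
    fun k => by positivity, fun k p q => ?_⟩
  · exact tendsto_atTop_mono (fun k => (le_add_of_nonneg_right zero_le_one).trans (hidx_r k))
      tendsto_natCast_atTop_atTop
  · simpa using (tendsto_one_div_add_atTop_nhds_zero_nat (𝕜 := ℝ)).const_mul (2 * L + 1)
  have hR := hr (idx k)
  have hδk := hidx_δ k
  have hp := hg k p
  have hq := hg k q
  obtain ⟨hφl, hφu⟩ := hφ (g k p) (g k q)
  obtain ⟨hhl, hhu⟩ := hqi (idx k) (φ (g k p)) (φ (g k q))
  have hscaled : dist (x + (r (idx k))⁻¹ • p.1) (x + (r (idx k))⁻¹ • q.1)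
      = (r (idx k))⁻¹ * dist p q := by
    rw [dist_add_left, dist_smul₀, Real.norm_of_nonneg (inv_nonneg.2 hR.le), Subtype.dist_eq]
  rw [le_div_iff₀ hR] at hhl
  rw [div_le_iff₀ hR] at hhu
  have hlo := dist_triangle4 (x + (r (idx k))⁻¹ • p.1) (g k p) (g k q) (x + (r (idx k))⁻¹ • q.1)
  have hup := dist_triangle4 (g k p).1 (x + (r (idx k))⁻¹ • p.1) (x + (r (idx k))⁻¹ • q.1) (g k q)
  rw [hscaled, dist_comm (g k q).1 (x + _), ← Subtype.dist_eq] at hlo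
  rw [hscaled, dist_comm (g k p).1 (x + _), ← Subtype.dist_eq] at hup
  exact rescaled_quasi_isometry_bounds hL hR (by linarith) (by linarith) hφl hφu hhl hhu hδk
end

section
/- Let n ≥ 1, L ≥ 1, D ≥ 0, and let X be a metric space with the following property: for every a ≥ 0, every Euclidean (n+1)-simplex Δ' and every map g : ∂Δ' → X whose restriction to each facet of Δ' is an (L,a)-quasi-isometric embedding, the image of each facet of Δ' lies within distance D(1+a) of the union of the images of the remaining facets. Let B ⊂ ℝ^{n+1} be the closed unit ball, let s > 0 and ε ≥ 0, and let f : s·B → X be an (L, ε·s)-quasi-isometric embedding, where s·B = {s·z : z ∈ B}. Then for every Euclidean (n+1)-simplex Δ contained in B, every facet F of Δ, and every point x ∈ F, one has L⁻¹·dist(x, M) − ε ≤ D(1/s + ε), where M denotes the union of the facets of Δ other than F and dist(x,M) the Euclidean distance from x to M. -/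
/-- The facet of the Euclidean `(n+1)`-simplex with vertices `v 0, …, v (n+1)` opposite to the
vertex `v j`: the convex hull of the remaining `n+1` vertices. -/
def facet {n : ℕ} (v : Fin (n + 2) → EuclideanSpace ℝ (Fin (n + 1))) (j : Fin (n + 2)) :
    Set (EuclideanSpace ℝ (Fin (n + 1))) :=
  convexHull ℝ (v '' ({j}ᶜ : Set (Fin (n + 2))))

open scoped Pointwise in
/-- Facets scale with the simplex. -/
theorem facet_smul {n : ℕ} (s : ℝ) (v : Fin (n + 2) → EuclideanSpace ℝ (Fin (n + 1)))
    (j : Fin (n + 2)) : facet (fun i => s • v i) j = (s • ·) '' facet v j := by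
  unfold facet
  rw [← Set.image_image (s • ·) v]
  exact convexHull_smul s _

theorem facet_subset_convexHull_range {n : ℕ} (v : Fin (n + 2) → EuclideanSpace ℝ (Fin (n + 1)))
    (j : Fin (n + 2)) : facet v j ⊆ convexHull ℝ (Set.range v) :=
  convexHull_mono (Set.image_subset_range _ _)

/-- Affine independence is preserved by scaling by a nonzero factor. -/
theorem AffineIndependent.const_smul_family {ι E : Type*} [AddCommGroup E] [Module ℝ E]
    {v : ι → E} (hv : AffineIndependent ℝ v) {s : ℝ} (hs : s ≠ 0) :
    AffineIndependent ℝ (fun i => s • v i) :=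
  hv.map' (LinearMap.lsmul ℝ E s).toAffineMap (smul_right_injective E hs)

/-- Let `n ≥ 1`, `L ≥ 1`, `D ≥ 0`, and let `X` be a metric space with the
slim simplices property: for every `a ≥ 0`, every Euclidean `(n+1)`-simplex `Δ'` (given by
affinely independent vertices `v'`), and every map `g` into `X` whose restriction to each
facet of `Δ'` is an `(L,a)`-quasi-isometric embedding, the image of each facet lies within
distance `D(1+a)` of the union of the images of the remaining facets. Let `B ⊆ ℝ^{n+1}` be
the closed unit ball, `s > 0`, `ε ≥ 0`, and `f : s·B → X` an `(L, ε·s)`-quasi-isometric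
embedding. Then for every `(n+1)`-simplex `Δ ⊆ B`, every facet `F` of `Δ` and every `x ∈ F`,
one has `L⁻¹·dist(x, M) − ε ≤ D(1/s + ε)`, where `M` is the union of the other facets. -/
theorem stmt_9 (n : ℕ) (hn : 1 ≤ n) (L D : ℝ) (hL : 1 ≤ L) (hD : 0 ≤ D)
    (X : Type) [MetricSpace X]
    (hslim : ∀ a : ℝ, 0 ≤ a →
      ∀ v' : Fin (n + 2) → EuclideanSpace ℝ (Fin (n + 1)), AffineIndependent ℝ v' →
        ∀ g : EuclideanSpace ℝ (Fin (n + 1)) → X,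
          (∀ j, ∀ p ∈ facet v' j, ∀ q ∈ facet v' j,
            L⁻¹ * dist p q - a ≤ dist (g p) (g q) ∧ dist (g p) (g q) ≤ L * dist p q + a) →
          ∀ j, ∀ p ∈ facet v' j,
            ∃ q ∈ ⋃ j' ∈ ({j}ᶜ : Set (Fin (n + 2))), facet v' j',
              dist (g p) (g q) ≤ D * (1 + a))
    (s ε : ℝ) (hs : 0 < s) (hε : 0 ≤ ε)
    (f : EuclideanSpace ℝ (Fin (n + 1)) → X)
    (hf : ∀ p ∈ Metric.closedBall (0 : EuclideanSpace ℝ (Fin (n + 1))) s,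
      ∀ q ∈ Metric.closedBall (0 : EuclideanSpace ℝ (Fin (n + 1))) s,
        L⁻¹ * dist p q - ε * s ≤ dist (f p) (f q) ∧ dist (f p) (f q) ≤ L * dist p q + ε * s)
    (v : Fin (n + 2) → EuclideanSpace ℝ (Fin (n + 1))) (hv : AffineIndependent ℝ v)
    (hΔB : convexHull ℝ (Set.range v) ⊆ Metric.closedBall (0 : EuclideanSpace ℝ (Fin (n + 1))) 1)
    (j : Fin (n + 2)) (x : EuclideanSpace ℝ (Fin (n + 1))) (hx : x ∈ facet v j) :
    L⁻¹ * Metric.infDist x (⋃ j' ∈ ({j}ᶜ : Set (Fin (n + 2))), facet v j') - ε ≤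
      D * (1 / s + ε) := by
  have hball : ∀ i, ∀ p ∈ facet v i,
      s • p ∈ Metric.closedBall (0 : EuclideanSpace ℝ (Fin (n + 1))) s := by
    intro i p hp
    have h := hΔB (facet_subset_convexHull_range v i hp)
    rw [mem_closedBall_zero_iff] at h ⊢
    rw [norm_smul, Real.norm_of_nonneg hs.le]
    exact mul_le_of_le_one_right hs.le h
  obtain ⟨q, hq, hqd⟩ := hslim (ε * s) (mul_nonneg hε hs.le) (fun i => s • v i)
    (hv.const_smul_family hs.ne') f (by
      intro i p hp q hq
      rw [facet_smul] at hp hq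
      obtain ⟨p, hp, rfl⟩ := hp
      obtain ⟨q, hq, rfl⟩ := hq
      exact hf _ (hball i p hp) _ (hball i q hq)) j (s • x)
    (by rw [facet_smul]; exact Set.mem_image_of_mem _ hx)
  simp only [Set.mem_iUnion, facet_smul] at hq
  obtain ⟨i, hi, y, hy, rfl⟩ := hq
  have hxy := (hf _ (hball j x hx) _ (hball i y hy)).1
  rw [dist_smul₀, Real.norm_of_nonneg hs.le] at hxy
  have hinf : Metric.infDist x (⋃ j' ∈ ({j}ᶜ : Set (Fin (n + 2))), facet v j') ≤ dist x y :=
    Metric.infDist_le_dist_of_mem (Set.mem_biUnion hi hy)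
  have hLpos : 0 < L := one_pos.trans_le hL
  calc L⁻¹ * Metric.infDist x (⋃ j' ∈ ({j}ᶜ : Set (Fin (n + 2))), facet v j') - ε
      ≤ L⁻¹ * dist x y - ε := by gcongr
    _ = (L⁻¹ * (s * dist x y) - ε * s) / s := by field_simp
    _ ≤ D * (1 + ε * s) / s := by gcongr; exact hxy.trans hqd
    _ = D * (1 / s + ε) := by field_simp
end
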